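/- Let b > 1 and let κ ∈ (−1, −1/b) be real numbers. Then there exists a unique t > 0 such that f⁻(t) = (1/κ)·tanh(t) + tanh(b·t) = 0; moreover f⁺(t) = κ·tanh(t) + tanh(b·t) > 0 for all t > 0. -/

import Mathlib

namespace Real

theorem tanh_strictMono : StrictMono tanh := fun x y hxy => by
  rw [tanh_eq_sinh_div_cosh, tanh_eq_sinh_div_cosh, div_lt_div_iff₀ (cosh_pos x) (cosh_pos y)]
  have h : 0 < sinh (y - x) := sinh_pos_iff.2 (sub_pos.2 hxy)
  rw [sinh_sub] at h
  linarith

/-- If `0 < q < p`, then `s ↦ cosh (q * s) / cosh (p * s)` strictly decreases on `(0, ∞)`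
(cross-multiplied form). -/
theorem cosh_mul_cosh_lt_of_lt {p q s t : ℝ} (hq : 0 < q) (hqp : q < p) (hs : 0 < s)
    (hst : s < t) : cosh (q * t) * cosh (p * s) < cosh (q * s) * cosh (p * t) := by
  have hpq : 0 < (p - q) * (t - s) := mul_pos (sub_pos.2 hqp) (sub_pos.2 hst)
  have hpq' : 0 < (p - q) * (t + s) := mul_pos (sub_pos.2 hqp) (by linarith)
  have hpq'' : 0 < (p + q) * (t - s) := mul_pos (by linarith) (sub_pos.2 hst)
  have hpos : 0 < q * t + p * s := by
    have := mul_pos hq (hs.trans hst)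
    have := mul_pos (hq.trans hqp) hs
    linarith
  have h₁ : cosh (q * t + p * s) < cosh (q * s + p * t) := by
    rw [cosh_lt_cosh, abs_of_pos hpos]
    exact lt_of_lt_of_le (by linarith) (le_abs_self _)
  have h₂ : cosh (q * t - p * s) < cosh (q * s - p * t) := by
    rw [cosh_lt_cosh, abs_sub_comm (q * s)]
    exact lt_of_lt_of_le (abs_lt.2 ⟨by linarith, by linarith⟩) (le_abs_self _)
  rw [cosh_add, cosh_add] at h₁
  rw [cosh_sub, cosh_sub] at h₂
  linarith

theorem hasDerivAt_mul_sinh_sub_mul_sinh (m n p q t : ℝ) :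
    HasDerivAt (fun t => m * sinh (p * t) - n * sinh (q * t))
      (m * p * cosh (p * t) - n * q * cosh (q * t)) t := by
  have h (r : ℝ) : HasDerivAt (fun t => sinh (r * t)) (cosh (r * t) * r) t := by
    simpa using ((hasDerivAt_id t).const_mul r).sinh
  exact (((h p).const_mul m).sub ((h q).const_mul n)).congr_deriv (by ring)

theorem mul_sinh_sub_mul_sinh_ne_zero {m n p q s t : ℝ} (hm : 0 < m) (hq : 0 < q)
    (hqp : q < p) (hs : 0 < s) (hst : s < t) (h : m * sinh (p * s) - n * sinh (q * s) = 0) :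
    m * sinh (p * t) - n * sinh (q * t) ≠ 0 := by
  intro h'
  have hd := hasDerivAt_mul_sinh_sub_mul_sinh m n p q
  have hc (a b : ℝ) : ContinuousOn (fun t => m * sinh (p * t) - n * sinh (q * t)) (Set.Icc a b) :=
    fun x _ => (hd x).continuousAt.continuousWithinAt
  obtain ⟨x, hx, hx'⟩ := exists_hasDerivAt_eq_zero hs (hc 0 s) (by simp [h]) fun x _ => hd x
  obtain ⟨y, hy, hy'⟩ := exists_hasDerivAt_eq_zero hst (hc s t) (by simp [h, h']) fun x _ => hd x
  have hlt := cosh_mul_cosh_lt_of_lt hq hqp hx.1 (hx.2.trans hy.1)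
  have heq : m * p * (cosh (q * y) * cosh (p * x)) = m * p * (cosh (q * x) * cosh (p * y)) := by
    linear_combination cosh (q * y) * hx' - cosh (q * x) * hy'
  exact hlt.ne (mul_left_cancel₀ (mul_pos hm (hq.trans hqp)).ne' heq)

theorem exists_mul_sinh_sub_mul_sinh_neg {m n p q ε : ℝ} (hε : 0 < ε) (h : m * p < n * q) :
    ∃ t ∈ Set.Ioo 0 ε, m * sinh (p * t) - n * sinh (q * t) < 0 := by
  have hd := (hasDerivAt_mul_sinh_sub_mul_sinh m n p q 0).tendsto_slope_zero_right
  have hneg := hd.eventually_lt_const (u := 0) (by simpa using h)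
  obtain ⟨t, ht, ht'⟩ := (hneg.and (Ioo_mem_nhdsGT hε)).exists
  refine ⟨t, ht', ?_⟩
  have := ht'.1
  simpa [inv_pos.2 this, mul_neg_iff, this.not_gt, this.le, this] using ht

end Real

/-- For b > 1 and κ ∈ (−1, −1/b), there is a unique t > 0 with
f⁻(t) = (1/κ)·tanh t + tanh(b·t) = 0, and f⁺(t) = κ·tanh t + tanh(b·t) > 0
for all t > 0. -/
theorem stmt_3 (b κ : ℝ) (hb : 1 < b) (hκ1 : -1 < κ) (hκ2 : κ < -(1/b)) :
    (∃! t : ℝ, 0 < t ∧ (1/κ) * Real.tanh t + Real.tanh (b * t) = 0) ∧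
    (∀ t : ℝ, 0 < t → 0 < κ * Real.tanh t + Real.tanh (b * t)) := by
  have hb0 : 0 < b := one_pos.trans hb
  have hκ0 : κ < 0 := hκ2.trans (neg_neg_of_pos (one_div_pos.2 hb0))
  have hbκ : κ * b < -1 := by
    rwa [← neg_div, lt_div_iff₀ hb0] at hκ2
  have key (t : ℝ) : (1 + κ) * Real.sinh ((b + 1) * t) - (1 - κ) * Real.sinh ((b - 1) * t) =
      2 * Real.cosh t * Real.cosh (b * t) * (Real.tanh t + κ * Real.tanh (b * t)) := by
    have := (Real.cosh_pos t).ne'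
    have := (Real.cosh_pos (b * t)).ne'
    rw [Real.tanh_eq_sinh_div_cosh, Real.tanh_eq_sinh_div_cosh, add_one_mul, sub_one_mul,
      Real.sinh_add, Real.sinh_sub]
    field_simp
    ring
  have hzero (t : ℝ) : (1 / κ) * Real.tanh t + Real.tanh (b * t) = 0 ↔
      (1 + κ) * Real.sinh ((b + 1) * t) - (1 - κ) * Real.sinh ((b - 1) * t) = 0 := by
    have hpos : 2 * Real.cosh t * Real.cosh (b * t) ≠ 0 := by
      have := Real.cosh_pos t
      have := Real.cosh_pos (b * t)
      positivity
    rw [key, mul_eq_zero_iff_left hpos]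
    have : Real.tanh t + κ * Real.tanh (b * t) =
        κ * ((1 / κ) * Real.tanh t + Real.tanh (b * t)) := by
      field_simp [hκ0.ne]
    rw [this, mul_eq_zero_iff_left hκ0.ne]
  have hne {s t : ℝ} := Real.mul_sinh_sub_mul_sinh_ne_zero (m := 1 + κ) (n := 1 - κ)
    (p := b + 1) (q := b - 1) (s := s) (t := t) (by linarith) (by linarith) (by linarith)
  refine ⟨?_, fun t ht => ?_⟩
  · have hT : 0 < Real.artanh (-κ) := Real.artanh_pos ⟨by linarith, by linarith⟩
    obtain ⟨s, hs, hs'⟩ := Real.exists_mul_sinh_sub_mul_sinh_neg (m := 1 + κ) (n := 1 - κ)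
      (p := b + 1) (q := b - 1) hT (by linarith)
    have hT' : 0 ≤ (1 + κ) * Real.sinh ((b + 1) * Real.artanh (-κ)) -
        (1 - κ) * Real.sinh ((b - 1) * Real.artanh (-κ)) := by
      rw [key, Real.tanh_artanh ⟨by linarith, by linarith⟩]
      have hlt := mul_pos (neg_pos.2 hκ0) (sub_pos.2 (Real.tanh_lt_one (b * Real.artanh (-κ))))
      refine mul_nonneg ?_ (by linarith)
      have := Real.cosh_pos (Real.artanh (-κ))
      have := Real.cosh_pos (b * Real.artanh (-κ))
      positivity
    obtain ⟨t, ht, ht'⟩ := intermediate_value_Icc hs.2.le (fun x _ =>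
      (Real.hasDerivAt_mul_sinh_sub_mul_sinh (1 + κ) (1 - κ) (b + 1) (b - 1)
        x).continuousAt.continuousWithinAt) ⟨hs'.le, hT'⟩
    have ht0 : 0 < t := hs.1.trans_le ht.1
    refine ⟨t, ⟨ht0, (hzero t).2 ht'⟩, fun u ⟨hu0, hu⟩ => ?_⟩
    rw [hzero] at hu
    rcases lt_trichotomy u t with h | h | h
    · exact (hne hu0 h hu ht').elim
    · exact h
    · exact (hne ht0 h ht' hu).elim
  · have h₀ : 0 < Real.tanh t := by simpa using Real.tanh_strictMono ht
    have h₁ := Real.tanh_strictMono (lt_mul_of_one_lt_left ht hb)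
    have h₂ := mul_pos (neg_lt_iff_pos_add.1 hκ1) h₀
    linarith
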